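/- arXiv:2004.14490 — 3 statements merged into one kernel-verified Lean document; each statement's English description precedes it below -/
import Mathlib

section
/- If G is a connected finite simple graph of order n and minimum degree δ, then avec(G) ≤ 9n/(4(δ+1)) + 15/4. -/
open SimpleGraph

/-- The eccentricity of a vertex `v`: the maximum distance from `v` to a vertex of `G`. -/
noncomputable def eccent {V : Type*} (G : SimpleGraph V) (v : V) : ℕ :=
  sSup (Set.range (G.dist v))

/-- The average eccentricity of a finite graph `G`. -/
noncomputable def avec {V : Type*} (G : SimpleGraph V) : ℝ :=
  (∑ᶠ v, (eccent G v : ℝ)) / (Nat.card V)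

/-- `G` contains no cycle of length `m` as a (not necessarily induced) subgraph. -/
def CycleFree {V : Type*} (G : SimpleGraph V) (m : ℕ) : Prop :=
  ∀ ⦃v : V⦄ (w : G.Walk v v), w.IsCycle → w.length ≠ m

/-- A `3`-packing `A` of `G` together with a tree metric `t` on `A` such that distances in `G`
are at most three times distances in the tree. -/
structure IsTreePacking {V : Type*} (G : SimpleGraph V) (A : Finset V) (t : V → V → ℕ) : Prop where
  self : ∀ a ∈ A, t a a = 0
  symm : ∀ a ∈ A, ∀ b ∈ A, t a b = t b a
  four_point : ∀ a ∈ A, ∀ b ∈ A, ∀ c ∈ A, ∀ e ∈ A,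
    t a b + t c e ≤ max (t a c + t b e) (t a e + t b c)
  geodesic : ∀ x ∈ A, ∀ y ∈ A, ∀ i ≤ t x y, ∃ v ∈ A, t x v = i ∧ t v y + i = t x y
  dist_le : ∀ a ∈ A, ∀ b ∈ A, G.dist a b ≤ 3 * t a b
  le_dist : ∀ a ∈ A, ∀ b ∈ A, a ≠ b → 3 ≤ G.dist a b

namespace IsTreePacking

variable {V : Type*} {G : SimpleGraph V} {A : Finset V} {t : V → V → ℕ}

lemma singleton (v : V) : IsTreePacking G {v} (fun _ _ => 0) where
  self := by simp
  symm := by simp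
  four_point := by simp
  geodesic := by simp
  dist_le := by simp
  le_dist := by simp

lemma triangle (h : IsTreePacking G A t) {a b c : V} (ha : a ∈ A) (hb : b ∈ A) (hc : c ∈ A) :
    t a b ≤ t a c + t c b := by
  have h1 := h.four_point a ha b hb c hc c hc
  have h2 := h.self c hc
  have h3 := h.symm b hb c hc
  omega

/-- A vertex at distance three from the packing can be attached as a leaf. -/
lemma exists_insert [DecidableEq V] (hG : G.Connected) (h : IsTreePacking G A t) {a b : V}
    (ha : a ∈ A) (hab : G.dist b a = 3) (hb : ∀ c ∈ A, 3 ≤ G.dist b c) :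
    ∃ t', IsTreePacking G (insert b A) t' := by
  have hbA : b ∉ A := fun hbA => by simpa using hb b hbA
  have hne : ∀ c ∈ A, c ≠ b := fun c hc hcb => hbA (hcb ▸ hc)
  let t' : V → V → ℕ := fun u v =>
    if u = b then (if v = b then 0 else t a v + 1) else if v = b then t u a + 1 else t u v
  have hbb : t' b b = 0 := by simp [t']
  have hbc : ∀ c ∈ A, t' b c = t a c + 1 := fun c hc => by simp [t', hne c hc]
  have hcb : ∀ c ∈ A, t' c b = t c a + 1 := fun c hc => by simp [t', hne c hc]
  have hcc : ∀ c ∈ A, ∀ e ∈ A, t' c e = t c e := fun c hc e he => by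
    simp [t', hne c hc, hne e he]
  clear_value t'
  refine ⟨t', ?_, ?_, ?_, ?_, ?_, ?_⟩
  · intro c hc
    rcases Finset.mem_insert.1 hc with rfl | hc
    · exact hbb
    · rw [hcc c hc c hc, h.self c hc]
  · intro c hc e he
    rw [Finset.mem_insert] at hc he
    rcases hc with rfl | hc <;> rcases he with rfl | he
    · rfl
    · rw [hbc e he, hcb e he, h.symm a ha e he]
    · rw [hbc c hc, hcb c hc, h.symm a ha c hc]
    · rw [hcc c hc e he, hcc e he c hc, h.symm c hc e he]
  · intro p hp q hq r hr s hs
    rw [Finset.mem_insert] at hp hq hr hs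
    rcases hp with rfl | hp <;> rcases hq with rfl | hq <;>
      rcases hr with rfl | hr <;> rcases hs with rfl | hs <;>
      simp only [*]
    all_goals try omega
    · have h1 := h.symm r hr a ha
      omega
    · have h1 := h.triangle hr hs ha
      have h2 := h.symm r hr a ha
      omega
    · have h1 := h.symm q hq a ha
      omega
    · have h1 := h.symm q hq a ha
      omega
    · have h1 := h.symm q hq a ha
      have h2 := h.symm r hr a ha
      omega
    · have h1 := h.four_point a ha q hq r hr s hs
      omega
    · have h1 := h.symm r hr a ha
      omega
    · have h1 := h.four_point p hp a ha r hr s hs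
      omega
    · have h1 := h.triangle hp hq ha
      have h2 := h.symm q hq a ha
      omega
    · have h1 := h.four_point p hp q hq a ha s hs
      omega
    · have h1 := h.four_point p hp q hq r hr a ha
      omega
    · exact h.four_point p hp q hq r hr s hs
  · intro x hx y hy i hi
    rw [Finset.mem_insert] at hx hy
    rcases hx with rfl | hx <;> rcases hy with rfl | hy
    · exact ⟨_, Finset.mem_insert_self _ _, by omega, by omega⟩
    · rcases i with _ | j
      · exact ⟨_, Finset.mem_insert_self _ _, hbb, by omega⟩
      · rw [hbc y hy] at hi ⊢
        obtain ⟨v, hv, h1, h2⟩ := h.geodesic a ha y hy j (by omega)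
        refine ⟨v, Finset.mem_insert_of_mem hv, ?_, ?_⟩
        · rw [hbc v hv, h1]
        · rw [hcc v hv y hy]
          omega
    · rw [hcb x hx] at hi ⊢
      rcases hi.lt_or_eq with hi | rfl
      · obtain ⟨v, hv, h1, h2⟩ := h.geodesic x hx a ha i (by omega)
        refine ⟨v, Finset.mem_insert_of_mem hv, ?_, ?_⟩
        · rw [hcc x hx v hv, h1]
        · rw [hcb v hv]
          omega
      · exact ⟨_, Finset.mem_insert_self _ _, hcb x hx, by omega⟩
    · rw [hcc x hx y hy] at hi ⊢
      obtain ⟨v, hv, h1, h2⟩ := h.geodesic x hx y hy i hi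
      exact ⟨v, Finset.mem_insert_of_mem hv, by rw [hcc x hx v hv, h1],
        by rw [hcc v hv y hy, h2]⟩
  · intro c hc e he
    rw [Finset.mem_insert] at hc he
    rcases hc with rfl | hc <;> rcases he with rfl | he
    · simp
    · rw [hbc e he]
      have h1 := hG.dist_triangle (u := c) (v := a) (w := e)
      have h2 := h.dist_le a ha e he
      omega
    · rw [hcb c hc]
      have h1 := hG.dist_triangle (u := c) (v := a) (w := e)
      have h2 := h.dist_le c hc a ha
      rw [G.dist_comm (u := a)] at h1
      omega
    · rw [hcc c hc e he]
      exact h.dist_le c hc e he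
  · intro c hc e he hce
    rw [Finset.mem_insert] at hc he
    rcases hc with rfl | hc <;> rcases he with rfl | he
    · exact absurd rfl hce
    · exact hb e he
    · rw [G.dist_comm]
      exact hb c hc
    · exact h.le_dist c hc e he hce

end IsTreePacking

/-- A connected finite graph has a tree packing that dominates all vertices within distance two. -/
lemma exists_isTreePacking_dominating {V : Type*} [Fintype V] {G : SimpleGraph V}
    (hG : G.Connected) :
    ∃ A t, IsTreePacking G A t ∧ A.Nonempty ∧ ∀ v, ∃ a ∈ A, G.dist v a ≤ 2 := by
  classical
  obtain ⟨v₀⟩ := hG.nonempty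
  let F : Finset (Finset V) :=
    Finset.univ.filter fun A => A.Nonempty ∧ ∃ t, IsTreePacking G A t
  have hF : F.Nonempty := ⟨{v₀}, by
    simpa [F] using ⟨_, IsTreePacking.singleton v₀⟩⟩
  obtain ⟨A, hAF, hmax⟩ := F.exists_max_image Finset.card hF
  obtain ⟨hA, t, ht⟩ := (Finset.mem_filter.1 hAF).2
  refine ⟨A, t, ht, hA, fun v => ?_⟩
  by_contra! hv
  obtain ⟨a, ha, hmin⟩ := A.exists_min_image (G.dist v) hA
  obtain ⟨p, hp⟩ := hG.exists_walk_length_eq_dist v a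
  have hva := hv a ha
  have h1 : G.dist v (p.getVert (p.length - 3)) ≤ p.length - 3 :=
    (dist_le (p.take (p.length - 3))).trans (by simp [Walk.take_length])
  have h2 : G.dist (p.getVert (p.length - 3)) a ≤ 3 :=
    (dist_le (p.drop (p.length - 3))).trans (by simp [Walk.drop_length]; omega)
  have h3 : ∀ c ∈ A, 3 ≤ G.dist (p.getVert (p.length - 3)) c := fun c hc => by
    have h4 := hmin c hc
    have h5 := hG.dist_triangle (u := v) (v := p.getVert (p.length - 3)) (w := c)
    omega
  obtain ⟨t', ht'⟩ := ht.exists_insert hG ha (h2.antisymm (h3 a ha)) h3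
  have hb : p.getVert (p.length - 3) ∉ A := fun hb => by simpa using h3 _ hb
  have h6 := hmax _ (Finset.mem_filter.2
    ⟨Finset.mem_univ _, Finset.insert_nonempty (p.getVert (p.length - 3)) A, t', ht'⟩)
  rw [Finset.card_insert_of_notMem hb] at h6
  omega

lemma sq_le_four_mul_sum_min (D : ℕ) :
    D ^ 2 ≤ 4 * (∑ i ∈ Finset.range (D + 1), min i (D - i)) + 1 := by
  induction D using Nat.twoStepInduction with
  | zero => simp
  | one => simp
  | more D ih _ =>
    have hsum : ∑ i ∈ Finset.range (D + 2 + 1), min i (D + 2 - i)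
        = (∑ i ∈ Finset.range (D + 1), min i (D - i)) + (D + 1) := by
      rw [Finset.sum_range_succ, Finset.sum_range_succ']
      have hstep : ∀ i ∈ Finset.range (D + 1),
          min (i + 1) (D + 2 - (i + 1)) = min i (D - i) + 1 := fun i hi => by
        have := Finset.mem_range.1 hi
        omega
      rw [Finset.sum_congr rfl hstep, Finset.sum_add_distrib]
      simp
    rw [hsum]
    nlinarith

/-- Some `D` bounds the number of vertices below and the total eccentricity above. -/
lemma exists_sum_eccent_le {V : Type*} [Fintype V] {G : SimpleGraph V} [DecidableRel G.Adj]
    (hG : G.Connected) :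
    ∃ D : ℕ, (G.minDegree + 1) * (D + 1) ≤ Fintype.card V ∧
      ∑ v, _root_.eccent G v + 3 * ((G.minDegree + 1) * ∑ i ∈ Finset.range (D + 1), min i (D - i)) ≤
        (4 + 3 * D) * Fintype.card V := by
  classical
  obtain ⟨A, t, ht, hA, hdom⟩ := exists_isTreePacking_dominating hG
  have := hG.nonempty
  obtain ⟨⟨x, y⟩, hxy, hmax⟩ :=
    (A ×ˢ A).exists_max_image (fun p => t p.1 p.2) (hA.product hA)
  obtain ⟨hx, hy⟩ := Finset.mem_product.1 hxy
  have hD : ∀ a ∈ A, ∀ b ∈ A, t a b ≤ t x y := fun a ha b hb =>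
    hmax (a, b) (Finset.mem_product.2 ⟨ha, hb⟩)
  generalize hDdef : t x y = D at hD
  have hgeo : ∀ i, ∃ v, i ≤ D → v ∈ A ∧ t x v = i ∧ t v y + i = D := fun i => by
    by_cases hi : i ≤ D
    · obtain ⟨v, hv, h1, h2⟩ := ht.geodesic x hx y hy i (by omega)
      exact ⟨v, fun _ => ⟨hv, h1, by omega⟩⟩
    · exact ⟨x, fun h => absurd h hi⟩
  choose p hp using hgeo
  let N : ℕ → Finset V := fun i => insert (p i) (G.neighborFinset (p i))
  have hNcard : ∀ i, G.minDegree + 1 ≤ (N i).card := fun i => by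
    simp only [N]
    rw [Finset.card_insert_of_notMem (by simp), G.card_neighborFinset_eq_degree]
    have := G.minDegree_le_degree (p i)
    omega
  have hNdist : ∀ i, ∀ v ∈ N i, G.dist v (p i) ≤ 1 := fun i v hv => by
    rcases Finset.mem_insert.1 hv with rfl | hv
    · simp
    · rw [G.dist_comm, dist_eq_one_iff_adj.2 ((G.mem_neighborFinset _ _).1 hv)]
  have hNinj : ∀ i ≤ D, ∀ j ≤ D, ∀ v, v ∈ N i → v ∈ N j → i = j := fun i hi j hj v hvi hvj => by
    by_contra hij
    have hne : p i ≠ p j := fun h => hij (by rw [← (hp i hi).2.1, ← (hp j hj).2.1, h])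
    have h1 := ht.le_dist _ (hp i hi).1 _ (hp j hj).1 hne
    have h2 := hG.dist_triangle (u := p i) (v := v) (w := p j)
    have h3 := hNdist i v hvi
    have h4 := hNdist j v hvj
    rw [G.dist_comm (u := p i) (v := v)] at h2
    omega
  have hecc : ∀ v, ∀ a ∈ A, ∀ M, G.dist v a ≤ 2 → (∀ b ∈ A, t a b ≤ M) →
      _root_.eccent G v ≤ 4 + 3 * M := fun v a ha M hva hM => by
    refine csSup_le (Set.range_nonempty _) ?_
    rintro _ ⟨w, rfl⟩
    obtain ⟨b, hb, hwb⟩ := hdom w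
    have h1 := hG.dist_triangle (u := v) (v := a) (w := w)
    have h2 := hG.dist_triangle (u := a) (v := b) (w := w)
    have h3 := ht.dist_le a ha b hb
    have h4 := hM b hb
    rw [G.dist_comm (u := b) (v := w)] at h2
    omega
  have hpM : ∀ i ≤ D, ∀ b ∈ A, t (p i) b ≤ max i (D - i) := fun i hi b hb => by
    obtain ⟨hpi, h1, h2⟩ := hp i hi
    have h3 := ht.four_point _ hpi b hb x hx y hy
    have h4 := ht.symm _ hpi x hx
    have h5 := hD b hb y hy
    have h6 := hD b hb x hx
    omega
  have hpoint : ∀ v, _root_.eccent G v +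
      3 * (∑ i ∈ Finset.range (D + 1), if v ∈ N i then min i (D - i) else 0) ≤ 4 + 3 * D := by
    intro v
    by_cases hv : ∃ i ≤ D, v ∈ N i
    · obtain ⟨i, hi, hvi⟩ := hv
      have h1 := hecc v (p i) (hp i hi).1 _ ((hNdist i v hvi).trans (by omega)) (hpM i hi)
      rw [Finset.sum_eq_single_of_mem i (Finset.mem_range.2 (by omega)), if_pos hvi]
      · omega
      · intro j hj hji
        have hj' := Finset.mem_range.1 hj
        exact if_neg fun hvj => hji (hNinj j (by omega) i hi v hvj hvi)
    · push Not at hv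
      rw [Finset.sum_eq_zero]
      · obtain ⟨a, ha, hva⟩ := hdom v
        exact hecc v a ha D hva (hD a ha)
      · intro j hj
        have hj' := Finset.mem_range.1 hj
        exact if_neg (hv j (by omega))
  refine ⟨D, ?_, ?_⟩
  · calc (G.minDegree + 1) * (D + 1) = ∑ i ∈ Finset.range (D + 1), (G.minDegree + 1) := by
          simp [mul_comm]
      _ ≤ ∑ i ∈ Finset.range (D + 1), (N i).card := Finset.sum_le_sum fun i _ => hNcard i
      _ = ((Finset.range (D + 1)).biUnion N).card := by
          refine (Finset.card_biUnion fun i hi j hj hij => ?_).symm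
          have hi' := Finset.mem_range.1 hi
          have hj' := Finset.mem_range.1 hj
          exact Finset.disjoint_left.2 fun v hvi hvj =>
            hij (hNinj i (by omega) j (by omega) v hvi hvj)
      _ ≤ Fintype.card V := Finset.card_le_univ _
  · have hswap : (G.minDegree + 1) * ∑ i ∈ Finset.range (D + 1), min i (D - i) ≤
        ∑ v, ∑ i ∈ Finset.range (D + 1), if v ∈ N i then min i (D - i) else 0 := by
      rw [Finset.sum_comm, Finset.mul_sum]
      refine Finset.sum_le_sum fun i _ => ?_
      rw [← Finset.sum_filter, Finset.sum_const, smul_eq_mul]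
      refine Nat.mul_le_mul_right _ ((hNcard i).trans_eq ?_)
      congr 1
      ext v
      simp
    have hsum := Finset.sum_le_sum fun v (_ : v ∈ Finset.univ) => hpoint v
    rw [Finset.sum_add_distrib, ← Finset.mul_sum, Finset.sum_const, smul_eq_mul,
      Finset.card_univ] at hsum
    rw [mul_comm (4 + 3 * D)]
    omega

theorem stmt_1 {V : Type*} [Fintype V] (G : SimpleGraph V) [DecidableRel G.Adj]
    (hG : G.Connected) (n δ : ℕ) (hn : n = Fintype.card V) (hδ : δ = G.minDegree) :
    avec G ≤ 9 * (n : ℝ) / (4 * ((δ : ℝ) + 1)) + 15 / 4 := by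
  have := hG.nonempty
  obtain ⟨D, hcard, hsum⟩ := exists_sum_eccent_le hG
  have hS := sq_le_four_mul_sum_min D
  rw [← hn, ← hδ] at hcard hsum
  have hn0 : 0 < n := hn ▸ Fintype.card_pos
  unfold avec
  rw [finsum_eq_sum_of_fintype, Nat.card_eq_fintype_card, ← hn]
  generalize (∑ i ∈ Finset.range (D + 1), min i (D - i)) = S at hS hsum
  have hsum' : (∑ v, (_root_.eccent G v : ℝ)) + 3 * (((δ : ℝ) + 1) * S) ≤ (4 + 3 * D) * n := by
    exact_mod_cast hsum
  have hS' : (D : ℝ) ^ 2 ≤ 4 * S + 1 := by exact_mod_cast hS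
  have hcard' : ((δ : ℝ) + 1) * (D + 1) ≤ n := by exact_mod_cast hcard
  have hn' : (0 : ℝ) < n := by exact_mod_cast hn0
  have hd : (0 : ℝ) < (δ : ℝ) + 1 := by positivity
  have hD0 : (0 : ℝ) ≤ D := Nat.cast_nonneg D
  generalize (δ : ℝ) + 1 = d at *
  obtain ⟨x, hx⟩ : ∃ x : ℝ, (n : ℝ) = d * x := ⟨n / d, by field_simp⟩
  rw [hx] at hcard' hsum' hn' ⊢
  have hxD : (D : ℝ) + 1 ≤ x := le_of_mul_le_mul_left hcard' hd
  have hfrac : 9 * (d * x) / (4 * d) = 9 * x / 4 := by field_simp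
  rw [hfrac, div_le_iff₀ hn']
  have hkey : (4 + 3 * D) * x - 3 * S ≤ (9 * x / 4 + 15 / 4) * x := by
    obtain ⟨y, hy, rfl⟩ : ∃ y : ℝ, 0 ≤ y ∧ x = D + 1 + y := ⟨x - (D + 1), by linarith, by ring⟩
    nlinarith [mul_nonneg hD0 hy, mul_nonneg hy hy]
  nlinarith [mul_le_mul_of_nonneg_left hkey hd.le]
end

section
/- Let G be a finite simple graph of girth at least 6, minimum degree δ ≥ 3 and maximum degree Δ. If v is a vertex of degree Δ, then the number of vertices at distance at most 3 from v satisfies |N_{≤3}(v)| ≥ Δδ + (δ−1)·√(Δ(δ−2)) + 3/2. -/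
open SimpleGraph

namespace SimpleGraph

variable {V : Type*} {G : SimpleGraph V}

/-- A graph of girth at least `6` contains no triangle. -/
lemma not_triangle_of_six_le_egirth (hg : 6 ≤ G.egirth) {a b c : V}
    (hab : G.Adj a b) (hbc : G.Adj b c) (hca : G.Adj c a) : False := by
  have hcyc : (Walk.cons hab (.cons hbc (.cons hca .nil))).IsCycle := by
    have := hab.ne; have := hbc.ne; have := hca.ne
    simp [Walk.isCycle_def, Walk.isTrail_def]
    grind
  have h := le_egirth.1 hg _ _ hcyc
  simp only [Walk.length_cons, Walk.length_nil] at h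
  exact absurd h (by decide)

/-- In a graph of girth at least `6`, distinct vertices have at most one common neighbor. -/
lemma eq_of_adj_of_six_le_egirth (hg : 6 ≤ G.egirth) {a b x y : V} (hab : a ≠ b)
    (hax : G.Adj a x) (hbx : G.Adj b x) (hay : G.Adj a y) (hby : G.Adj b y) : x = y := by
  by_contra hxy
  have hcyc : (Walk.cons hax (.cons hbx.symm (.cons hby (.cons hay.symm .nil)))).IsCycle := by
    have := hax.ne; have := hbx.ne; have := hay.ne; have := hby.ne
    simp [Walk.isCycle_def, Walk.isTrail_def]
    grind
  have h := le_egirth.1 hg _ _ hcyc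
  simp only [Walk.length_cons, Walk.length_nil] at h
  exact absurd h (by decide)

/-- In a graph of girth at least `6`, two vertices joined to a vertex by paths of length `2`
are not adjacent. -/
lemma not_adj_of_six_le_egirth (hg : 6 ≤ G.egirth) {v a b x y : V} (hxv : x ≠ v) (hyv : y ≠ v)
    (hva : G.Adj v a) (hvb : G.Adj v b) (hax : G.Adj a x) (hby : G.Adj b y) : ¬ G.Adj x y := by
  intro hxy
  have hab : a ≠ b := by
    rintro rfl
    exact not_triangle_of_six_le_egirth hg hax hxy hby.symm
  have hay : a ≠ y := by
    rintro rfl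
    exact not_triangle_of_six_le_egirth hg hva hby.symm hvb.symm
  have hbx : b ≠ x := by
    rintro rfl
    exact not_triangle_of_six_le_egirth hg hva hax hvb.symm
  have hcyc : (Walk.cons hva (.cons hax (.cons hxy
      (.cons hby.symm (.cons hvb.symm .nil))))).IsCycle := by
    have := hva.ne; have := hvb.ne; have := hax.ne; have := hby.ne; have := hxy.ne
    simp [Walk.isCycle_def, Walk.isTrail_def]
    grind
  have h := le_egirth.1 hg _ _ hcyc
  simp only [Walk.length_cons, Walk.length_nil] at h
  exact absurd h (by decide)

end SimpleGraph

/-- If every member of a family of finite sets has at least `k` elements and any two members share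
at most one element, then counting ordered pairs bounds the size of the union from below. -/
lemma Finset.card_mul_le_card_biUnion_sq {α β : Type*} [DecidableEq β] (s : Finset α)
    (f : α → Finset β) (k : ℕ) (hk : ∀ x ∈ s, k ≤ (f x).card)
    (hf : ∀ x ∈ s, ∀ x' ∈ s, x ≠ x' → ∀ y ∈ f x, ∀ z ∈ f x, y ∈ f x' → z ∈ f x' → y = z) :
    s.card * (k * (k - 1)) ≤ (s.biUnion f).card * ((s.biUnion f).card - 1) := by
  have hdisj : (s : Set α).PairwiseDisjoint fun x => (f x).offDiag := by
    intro x hx x' hx' hne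
    refine Finset.disjoint_left.2 fun p hp hp' => ?_
    rw [Finset.mem_offDiag] at hp hp'
    exact hp.2.2 (hf x hx x' hx' hne _ hp.1 _ hp.2.1 hp'.1 hp'.2.1)
  calc s.card * (k * (k - 1)) ≤ ∑ x ∈ s, (f x).offDiag.card := by
        rw [← smul_eq_mul]
        refine Finset.card_nsmul_le_sum _ _ _ fun x hx => ?_
        rw [Finset.offDiag_card, ← Nat.mul_sub_one]
        exact Nat.mul_le_mul (hk x hx) (Nat.sub_le_sub_right (hk x hx) 1)
    _ = (s.biUnion fun x => (f x).offDiag).card := (Finset.card_biUnion hdisj).symm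
    _ ≤ (s.biUnion f).offDiag.card := by
        refine Finset.card_le_card (Finset.biUnion_subset.2 fun x hx => ?_)
        exact Finset.offDiag_mono (Finset.subset_biUnion_of_mem f hx)
    _ = _ := by rw [Finset.offDiag_card, ← Nat.mul_sub_one]

theorem stmt_4 {V : Type*} [Fintype V] (G : SimpleGraph V) [DecidableRel G.Adj]
    (hg : 6 ≤ G.egirth) (δ Δ : ℕ) (hδ : δ = G.minDegree) (h3 : 3 ≤ δ)
    (hΔ : Δ = G.maxDegree) (v : V) (hv : G.degree v = Δ) :
    (Δ : ℝ) * δ + ((δ : ℝ) - 1) * Real.sqrt ((Δ : ℝ) * ((δ : ℝ) - 2)) + 3 / 2 ≤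
      ({x : V | G.edist v x ≤ 3}.ncard : ℝ) := by
  classical
  have hdeg (u : V) : δ ≤ G.degree u := hδ ▸ G.minDegree_le_degree u
  set A := G.neighborFinset v with hA
  set B := A.biUnion fun u => (G.neighborFinset u).erase v with hB
  set C := B.biUnion fun x => G.neighborFinset x \ A with hC
  have memB {x : V} : x ∈ B ↔ x ≠ v ∧ ∃ u, G.Adj v u ∧ G.Adj u x := by
    simp [hA, hB]; tauto
  have memC {y : V} : y ∈ C ↔ ¬ G.Adj v y ∧ ∃ x ∈ B, G.Adj x y := by
    simp [hA, hC]; tauto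
  have cardA : A.card = Δ := by rw [← hv]; rfl
  have cardB : Δ * (δ - 1) ≤ B.card := by
    rw [hB, Finset.card_biUnion, ← cardA, ← smul_eq_mul]
    · refine Finset.card_nsmul_le_sum _ _ _ fun u hu => ?_
      rw [Finset.card_erase_of_mem (by simpa [hA, G.adj_comm] using hu),
        card_neighborFinset_eq_degree]
      exact Nat.sub_le_sub_right (hdeg u) 1
    · intro u hu u' hu' hne
      refine Finset.disjoint_left.2 fun x hx hx' => ?_
      simp only [hA, SetLike.mem_coe, mem_neighborFinset, Finset.mem_erase] at hu hu' hx hx'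
      exact hx.1 (eq_of_adj_of_six_le_egirth hg hne hu.symm hu'.symm hx.2 hx'.2).symm
  have degC : ∀ x ∈ B, δ - 1 ≤ (G.neighborFinset x \ A).card := by
    intro x hx
    have hone : (G.neighborFinset x ∩ A).card ≤ 1 := by
      refine Finset.card_le_one.2 fun a ha b hb => ?_
      simp only [hA, Finset.mem_inter, mem_neighborFinset] at ha hb
      exact eq_of_adj_of_six_le_egirth hg (memB.1 hx).1 ha.1 ha.2 hb.1 hb.2
    have := Finset.card_sdiff_add_card_inter (G.neighborFinset x) A
    have := hdeg x
    rw [card_neighborFinset_eq_degree] at *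
    omega
  have cardC : B.card * ((δ - 1) * (δ - 1 - 1)) ≤ C.card * (C.card - 1) := by
    refine Finset.card_mul_le_card_biUnion_sq B _ _ degC ?_
    intro x _ x' _ hne y hy z hz hy' hz'
    simp only [Finset.mem_sdiff, mem_neighborFinset] at hy hz hy' hz'
    exact eq_of_adj_of_six_le_egirth hg hne hy.1 hy'.1 hz.1 hz'.1
  have hvA : v ∉ A := by simp [hA]
  have hAB : Disjoint (insert v A) B := by
    refine Finset.disjoint_left.2 fun x hx hxB => ?_
    obtain ⟨hxv, u, hvu, hux⟩ := memB.1 hxB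
    rcases Finset.mem_insert.1 hx with rfl | hx
    · exact hxv rfl
    · exact not_triangle_of_six_le_egirth hg hvu hux ((G.mem_neighborFinset v x).1 hx).symm
  have hABC : Disjoint (insert v A ∪ B) C := by
    refine Finset.disjoint_left.2 fun y hy hyC => ?_
    obtain ⟨hvy, x, hxB, hxy⟩ := memC.1 hyC
    obtain ⟨hxv, u, hvu, hux⟩ := memB.1 hxB
    rcases Finset.mem_union.1 hy with hy | hy
    · rcases Finset.mem_insert.1 hy with rfl | hy
      · exact not_triangle_of_six_le_egirth hg hvu hux hxy
      · exact hvy ((G.mem_neighborFinset v y).1 hy)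
    · obtain ⟨hyv, u', hvu', hu'y⟩ := memB.1 hy
      exact not_adj_of_six_le_egirth hg hxv hyv hvu hvu' hux hu'y hxy
  have hsub : ((insert v A ∪ B ∪ C : Finset V) : Set V) ⊆ {x : V | G.edist v x ≤ 3} := by
    intro y hy
    have key : ∃ p : G.Walk v y, p.length ≤ 3 := by
      rcases Finset.mem_union.1 (Finset.mem_coe.1 hy) with hy | hy
      · rcases Finset.mem_union.1 hy with hy | hy
        · rcases Finset.mem_insert.1 hy with rfl | hy
          · exact ⟨.nil, by simp⟩
          · exact ⟨.cons ((G.mem_neighborFinset v y).1 hy) .nil, by simp⟩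
        · obtain ⟨-, u, hvu, huy⟩ := memB.1 hy
          exact ⟨.cons hvu (.cons huy .nil), by simp⟩
      · obtain ⟨-, x, hxB, hxy⟩ := memC.1 hy
        obtain ⟨-, u, hvu, hux⟩ := memB.1 hxB
        exact ⟨.cons hvu (.cons hux (.cons hxy .nil)), by simp⟩
    obtain ⟨p, hp⟩ := key
    exact (edist_le p).trans (by exact_mod_cast hp)
  have hcard : Δ + 1 + B.card + C.card ≤ {x : V | G.edist v x ≤ 3}.ncard := by
    have := Set.ncard_le_ncard hsub (Set.toFinite _)
    rwa [Set.ncard_coe_finset, Finset.card_union_of_disjoint hABC,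
      Finset.card_union_of_disjoint hAB, Finset.card_insert_of_notMem hvA, cardA] at this
  obtain ⟨k, rfl⟩ : ∃ k, δ = k + 3 := ⟨δ - 3, by omega⟩
  have hΔpos : 0 < Δ := by have := hdeg v; omega
  have hpairs := (Nat.mul_le_mul_right ((k + 2) * (k + 1)) cardB).trans cardC
  have hCpos : 1 ≤ C.card := by
    by_contra! h
    have h0 : C.card = 0 := by omega
    rw [h0, Nat.zero_mul] at hpairs
    have : 0 < Δ * (k + 3 - 1) * ((k + 2) * (k + 1)) := by
      have : 0 < k + 3 - 1 := by omega
      positivity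
    omega
  obtain ⟨c, hc⟩ : ∃ c, C.card = c + 1 := ⟨C.card - 1, by omega⟩
  rw [hc] at hpairs hcard
  have hpairsR : (Δ : ℝ) * (k + 2) * ((k + 2) * (k + 1)) ≤ (c + 1) * c := by exact_mod_cast hpairs
  have hcardR : (Δ : ℝ) + 1 + B.card + (c + 1) ≤ ({x : V | G.edist v x ≤ 3}.ncard : ℝ) := by
    exact_mod_cast hcard
  have hBR : (Δ : ℝ) * (k + 2) ≤ B.card := by exact_mod_cast cardB
  have hsqrt : ((k : ℝ) + 2) * Real.sqrt (Δ * (k + 1)) ≤ c + 1 / 2 := by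
    refine abs_le_of_sq_le_sq' ?_ (by positivity) |>.2
    rw [mul_pow, Real.sq_sqrt (by positivity)]
    nlinarith
  have h1 : (((k + 3 : ℕ) : ℝ) - 1) = k + 2 := by push_cast; ring
  have h2 : (((k + 3 : ℕ) : ℝ) - 2) = k + 1 := by push_cast; ring
  rw [h1, h2]
  push_cast
  linarith
end

section
/- Let G be a connected finite simple graph of order n, minimum degree δ ≥ 3 and girth at least 6. Then avec(G) ≤ (9/2)·⌈n/δ*⌉ + 8, where δ* = 2δ² − 2δ + 2. -/
open SimpleGraph

namespace SimpleGraph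

section Tree

variable {α : Type*} {T : SimpleGraph α}

/-- In a tree, every vertex `v` of the path from `x` to `y` lies between any vertex `z` and one of
the ends of the path. -/
theorem IsTree.dist_add_dist_le_or (hT : T.IsTree) {x y v : α} {p : T.Walk x y} (hp : p.IsPath)
    (hv : v ∈ p.support) (z : α) :
    T.dist v x + T.dist v z ≤ T.dist x z ∨ T.dist v y + T.dist v z ≤ T.dist z y := by
  classical
  obtain ⟨q, -, hq⟩ := hT.connected.exists_path_of_dist x z
  obtain ⟨r, -, hr⟩ := hT.connected.exists_path_of_dist z y
  have hpq : p = (q.append r).bypass :=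
    congrArg Subtype.val ((hT.isAcyclic.subsingleton_path x y).elim ⟨p, hp⟩
      ⟨_, (q.append r).bypass_isPath⟩)
  have hmem : v ∈ (q.append r).support := (q.append r).support_bypass_subset_support (hpq ▸ hv)
  rcases (Walk.mem_support_append_iff _ _).1 hmem with h | h
  · left
    have hlen := congrArg Walk.length (q.take_spec h)
    rw [Walk.length_append] at hlen
    have h₁ := dist_le (q.takeUntil v h)
    have h₂ := dist_le (q.dropUntil v h)
    rw [dist_comm (u := v) (v := x)]
    omega
  · right
    have hlen := congrArg Walk.length (r.take_spec h)
    rw [Walk.length_append] at hlen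
    have h₁ := dist_le (r.takeUntil v h)
    have h₂ := dist_le (r.dropUntil v h)
    rw [dist_comm (u := v) (v := z)]
    omega

theorem sq_le_four_mul_sum_min (D : ℕ) :
    D ^ 2 ≤ 4 * ∑ j ∈ Finset.range (D + 1), min j (D - j) + 1 := by
  induction D using Nat.twoStepInduction with
  | zero => simp
  | one => simp
  | more D ih _ =>
    have hstep : ∑ j ∈ Finset.range (D + 2 + 1), min j (D + 2 - j)
        = ∑ j ∈ Finset.range (D + 1), min j (D - j) + (D + 1) := by
      rw [Finset.sum_range_succ, Finset.sum_range_succ']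
      have : ∀ j ∈ Finset.range (D + 1), min (j + 1) (D + 2 - (j + 1)) = min j (D - j) + 1 := by
        intro j hj
        have := Finset.mem_range.1 hj
        omega
      rw [Finset.sum_congr rfl this, Finset.sum_add_distrib]
      simp
    rw [hstep]
    nlinarith

/-- The weighted sum of the eccentricities of a tree whose weights are at least `1` and sum to `N`
is at most `N (3 N / 4 - 1 / 2)`. -/
theorem IsTree.sum_weight_mul_dist_le [Fintype α] (hT : T.IsTree) (w : α → ℝ) (hw : ∀ i, 1 ≤ w i)
    (f : α → α) :
    ∑ i, w i * (T.dist i (f i) : ℝ) ≤ (∑ i, w i) * (3 / 4 * (∑ i, w i) - 1 / 2) := by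
  classical
  have := hT.connected.nonempty
  obtain ⟨⟨x, y⟩, hxy⟩ := Finite.exists_max (fun q : α × α => T.dist q.1 q.2)
  replace hxy : ∀ a b, T.dist a b ≤ T.dist x y := fun a b => hxy (a, b)
  obtain ⟨p, hp, hlen⟩ := hT.connected.exists_path_of_dist x y
  set D := T.dist x y with hD
  have hinj : Set.InjOn p.getVert (Finset.range (D + 1) : Set ℕ) := fun i hi j hj hij =>
    hp.getVert_injOn (by simp at hi ⊢; omega) (by simp at hj ⊢; omega) hij
  have hpath : ∀ j ∈ Finset.range (D + 1),
      min j (D - j) + T.dist (p.getVert j) (f (p.getVert j)) ≤ D := by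
    intro j hj
    have hjD : j ≤ D := by simpa [Nat.lt_succ_iff] using hj
    set v := p.getVert j with hv
    have htri : T.dist x y ≤ T.dist x v + T.dist v y := hT.connected.dist_triangle
    have hvx : T.dist x v ≤ j := (dist_le (p.take j)).trans (by simp)
    have hvy : T.dist v y ≤ D - j := (dist_le (p.drop j)).trans (by simp [hlen])
    rw [← hD] at htri
    rcases hT.dist_add_dist_le_or hp (p.getVert_mem_support j) (f v) with h | h
    · have := hxy x (f v)
      rw [← hv, dist_comm (u := v) (v := x)] at h
      omega
    · have := hxy (f v) y
      rw [← hv] at h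
      omega
  have hsum : (∑ j ∈ Finset.range (D + 1), (min j (D - j) : ℕ) : ℝ)
      ≤ ∑ i, ((D : ℝ) - T.dist i (f i)) := by
    calc (∑ j ∈ Finset.range (D + 1), (min j (D - j) : ℕ) : ℝ)
        ≤ ∑ j ∈ Finset.range (D + 1),
            ((D : ℝ) - T.dist (p.getVert j) (f (p.getVert j))) := by
          refine Finset.sum_le_sum fun j hj => ?_
          have := hpath j hj
          rw [le_sub_iff_add_le]
          exact_mod_cast this
      _ = ∑ i ∈ (Finset.range (D + 1)).image p.getVert, ((D : ℝ) - T.dist i (f i)) :=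
          by
          rw [Finset.sum_image hinj]
      _ ≤ ∑ i, ((D : ℝ) - T.dist i (f i)) := by
          refine Finset.sum_le_sum_of_subset_of_nonneg (Finset.subset_univ _) fun i _ _ => ?_
          exact sub_nonneg.2 (by exact_mod_cast hxy i (f i))
  have hN : (D : ℝ) + 1 ≤ ∑ i, w i := by
    have hcard : D + 1 ≤ Fintype.card α := by
      rw [← Finset.card_range (D + 1), ← Finset.card_image_of_injOn hinj]
      exact Finset.card_le_univ _
    calc (D : ℝ) + 1 ≤ Fintype.card α := by exact_mod_cast hcard
      _ = ∑ _i : α, (1 : ℝ) := by simp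
      _ ≤ ∑ i, w i := Finset.sum_le_sum fun i _ => hw i
  have hterm : ∑ i, w i * (T.dist i (f i) : ℝ)
      ≤ (∑ i, w i) * D - ∑ i, ((D : ℝ) - T.dist i (f i)) := by
    rw [Finset.sum_mul, ← Finset.sum_sub_distrib]
    refine Finset.sum_le_sum fun i _ => ?_
    have : (T.dist i (f i) : ℝ) ≤ D := by exact_mod_cast hxy i (f i)
    nlinarith [hw i]
  have hsq : (D : ℝ) ^ 2 ≤ 4 * (∑ j ∈ Finset.range (D + 1), (min j (D - j) : ℕ) : ℝ) + 1 := by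
    exact_mod_cast sq_le_four_mul_sum_min D
  have hD0 : (0 : ℝ) ≤ D := D.cast_nonneg
  nlinarith [mul_nonneg (sub_nonneg.2 hN)
    (by linarith : (0 : ℝ) ≤ 3 * (∑ i, w i) - (D + 1) + 2)]

end Tree

section Girth

variable {V : Type*} {G : SimpleGraph V}

theorem not_adj_of_adj_of_adj (hg : 6 ≤ G.egirth) {a b c : V} (hab : G.Adj a b)
    (hbc : G.Adj b c) : ¬ G.Adj c a := by
  intro hca
  have hcyc : (Walk.cons hab (.cons hbc (.cons hca .nil))).IsCycle := by
    have := hab.ne; have := hbc.ne; have := hca.ne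
    simp [Walk.cons_isCycle_iff, Walk.cons_isPath_iff]
    grind
  have := hg.trans (egirth_le_length hcyc)
  exact absurd this (by simp; norm_cast)

theorem eq_of_common_neighbors (hg : 6 ≤ G.egirth) {u a b z : V} (hua : G.Adj u a)
    (haz : G.Adj a z) (hub : G.Adj u b) (hbz : G.Adj b z) (hzu : z ≠ u) : a = b := by
  by_contra hab
  have hcyc : (Walk.cons hua (.cons haz (.cons hbz.symm (.cons hub.symm .nil)))).IsCycle := by
    have := hua.ne; have := haz.ne; have := hub.ne; have := hbz.ne
    simp [Walk.cons_isCycle_iff, Walk.cons_isPath_iff]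
    grind
  have := hg.trans (egirth_le_length hcyc)
  exact absurd this (by simp; norm_cast)

theorem not_adj_of_path_of_length_four (hg : 6 ≤ G.egirth) {a b c d e : V} (hab : G.Adj a b)
    (hbc : G.Adj b c) (hcd : G.Adj c d) (hde : G.Adj d e) : ¬ G.Adj e a := by
  intro hea
  have hac : a ≠ c := by rintro rfl; exact not_adj_of_adj_of_adj hg hcd hde hea
  have had : a ≠ d := by rintro rfl; exact not_adj_of_adj_of_adj hg hab hbc hcd
  have hbd : b ≠ d := by rintro rfl; exact not_adj_of_adj_of_adj hg hab hde hea
  have hbe : b ≠ e := by rintro rfl; exact not_adj_of_adj_of_adj hg hbc hcd hde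
  have hce : c ≠ e := by rintro rfl; exact not_adj_of_adj_of_adj hg hab hbc hea
  have hcyc : (Walk.cons hab (.cons hbc (.cons hcd (.cons hde (.cons hea .nil))))).IsCycle := by
    have := hab.ne; have := hbc.ne; have := hcd.ne; have := hde.ne; have := hea.ne
    simp [Walk.cons_isCycle_iff, Walk.cons_isPath_iff]
    grind
  have := hg.trans (egirth_le_length hcyc)
  exact absurd this (by simp; norm_cast)

/-- The vertices reached from an end of `e` by a walk of length two. -/
def twoStepNeighbors (G : SimpleGraph V) (e : Sym2 V) : Set V :=
  {z | ∃ a ∈ e, ∃ b, G.Adj a b ∧ G.Adj b z}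

theorem le_card_biUnion_neighborFinset [Fintype V] [DecidableEq V] [DecidableRel G.Adj]
    (hg : 6 ≤ G.egirth) (hδ : 1 ≤ G.minDegree) (u : V) :
    1 + G.minDegree * (G.minDegree - 1)
      ≤ ((G.neighborFinset u).biUnion fun a => G.neighborFinset a).card := by
  have hsub : insert u ((G.neighborFinset u).biUnion fun a => (G.neighborFinset a).erase u)
      ⊆ (G.neighborFinset u).biUnion fun a => G.neighborFinset a := by
    refine Finset.insert_subset ?_ (Finset.biUnion_mono fun a _ => Finset.erase_subset _ _)
    obtain ⟨a, ha⟩ := (G.degree_pos_iff_exists_adj u).1 (hδ.trans (G.minDegree_le_degree u))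
    simpa using ⟨a, ha, ha.symm⟩
  refine le_trans ?_ (Finset.card_le_card hsub)
  rw [Finset.card_insert_of_notMem (by simp), Finset.card_biUnion, add_comm, add_le_add_iff_right]
  · calc G.minDegree * (G.minDegree - 1)
        ≤ (G.neighborFinset u).card * (G.minDegree - 1) := by
          gcongr
          exact G.minDegree_le_degree u
      _ = ∑ _a ∈ G.neighborFinset u, (G.minDegree - 1) := by simp
      _ ≤ _ := by
          refine Finset.sum_le_sum fun a ha => ?_
          rw [Finset.card_erase_of_mem (by simpa using (G.mem_neighborFinset u a).1 ha |>.symm)]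
          exact Nat.sub_le_sub_right (G.minDegree_le_degree a) 1
  · intro a ha b hb hab
    rw [Function.onFun, Finset.disjoint_left]
    intro z hza hzb
    simp only [Finset.mem_coe, mem_neighborFinset, Finset.mem_erase] at ha hb hza hzb
    exact hab (eq_of_common_neighbors hg ha hza.2 hb hzb.2 hza.1)

theorem le_ncard_twoStepNeighbors [Fintype V] [DecidableRel G.Adj]
    (hg : 6 ≤ G.egirth) (hδ : 1 ≤ G.minDegree) {e : Sym2 V} (he : e ∈ G.edgeSet) :
    2 * G.minDegree ^ 2 - 2 * G.minDegree + 2 ≤ (G.twoStepNeighbors e).ncard := by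
  classical
  induction e with | _ u v =>
  rw [mem_edgeSet] at he
  have hset : G.twoStepNeighbors s(u, v)
      = (((G.neighborFinset u).biUnion (fun a => G.neighborFinset a) ∪
        (G.neighborFinset v).biUnion (fun a => G.neighborFinset a) : Finset V) : Set V) := by
    ext z
    simp [twoStepNeighbors]
  rw [hset, Set.ncard_coe_finset, Finset.card_union_of_disjoint]
  · have h₁ := le_card_biUnion_neighborFinset hg hδ u
    have h₂ := le_card_biUnion_neighborFinset hg hδ v
    have : 2 * G.minDegree ^ 2 - 2 * G.minDegree = 2 * (G.minDegree * (G.minDegree - 1)) := by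
      rw [Nat.mul_sub, Nat.mul_sub, sq, mul_one]
    omega
  · rw [Finset.disjoint_left]
    intro z hzu hzv
    simp only [Finset.mem_biUnion, mem_neighborFinset] at hzu hzv
    obtain ⟨a, hua, haz⟩ := hzu
    obtain ⟨b, hvb, hbz⟩ := hzv
    exact not_adj_of_path_of_length_four hg haz.symm hua.symm he hvb hbz

theorem dist_le_two_of_mem_twoStepNeighbors {e : Sym2 V} {z : V}
    (hz : z ∈ G.twoStepNeighbors e) : ∃ a ∈ e, G.dist z a ≤ 2 := by
  obtain ⟨a, ha, b, hab, hbz⟩ := hz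
  exact ⟨a, ha, dist_le (.cons hbz.symm (.cons hab.symm .nil))⟩

end Girth

section Packing

variable {V : Type*} {G : SimpleGraph V}

/-- The graph on pairs of vertices in which two pairs are adjacent if they are at distance at most
five in `G`. -/
def closePairs (G : SimpleGraph V) : SimpleGraph (Sym2 V) where
  Adj e f := e ≠ f ∧ ∃ a ∈ e, ∃ b ∈ f, G.dist a b ≤ 5
  symm := ⟨fun _ _ ⟨hne, a, ha, b, hb, h⟩ => ⟨hne.symm, b, hb, a, ha, dist_comm.trans_le h⟩⟩
  loopless := ⟨fun _ h => h.1 rfl⟩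

/-- A set of edges of `G` that are pairwise at distance at least five, connected through pairs at
distance exactly five. -/
structure IsLinkedPacking (G : SimpleGraph V) (M : Set (Sym2 V)) : Prop where
  subset_edgeSet : M ⊆ G.edgeSet
  five_le_dist : ∀ e ∈ M, ∀ f ∈ M, e ≠ f → ∀ a ∈ e, ∀ b ∈ f, 5 ≤ G.dist a b
  connected : (G.closePairs.induce M).Connected

theorem dist_le_one_of_mem_edge {e : Sym2 V} (he : e ∈ G.edgeSet) {a b : V} (ha : a ∈ e)
    (hb : b ∈ e) : G.dist a b ≤ 1 := by
  induction e with | _ u v =>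
  rw [mem_edgeSet] at he
  have h₁ := dist_eq_one_iff_adj.2 he
  have h₂ := dist_eq_one_iff_adj.2 he.symm
  rcases Sym2.mem_iff.1 ha with rfl | rfl <;> rcases Sym2.mem_iff.1 hb with rfl | rfl <;>
    simp [h₁, h₂]

theorem IsLinkedPacking.dist_le_of_walk (hG : G.Connected) {M : Set (Sym2 V)}
    (hM : G.IsLinkedPacking M) {e f : M} (p : (G.closePairs.induce M).Walk e f) {a b : V}
    (ha : a ∈ e.1) (hb : b ∈ f.1) : G.dist a b ≤ 6 * p.length + 1 := by
  induction p generalizing a with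
  | nil => simpa using dist_le_one_of_mem_edge (hM.subset_edgeSet (Subtype.property _)) ha hb
  | @cons e f' f hadj p ih =>
    obtain ⟨a', ha', c, hc, hac⟩ := (induce_adj.1 hadj).2
    have h₁ := dist_le_one_of_mem_edge (hM.subset_edgeSet e.2) ha ha'
    have h₂ := ih hc hb
    have h₃ : G.dist a b ≤ G.dist a a' + G.dist a' b := hG.dist_triangle
    have h₄ : G.dist a' b ≤ G.dist a' c + G.dist c b := hG.dist_triangle
    rw [Walk.length_cons]
    omega

/-- If some edge is at distance at least five from all of `M`, then so is an edge at distance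
exactly five from `M`. -/
theorem exists_edge_at_dist_five (hG : G.Connected) {M : Set (Sym2 V)} (hM : M.Nonempty)
    {e : Sym2 V} (he : e ∈ G.edgeSet)
    (hfar : ∀ a ∈ e, ∀ f ∈ M, ∀ b ∈ f, 5 ≤ G.dist a b) :
    ∃ e ∈ G.edgeSet, (∀ a ∈ e, ∀ f ∈ M, ∀ b ∈ f, 5 ≤ G.dist a b) ∧
      ∃ a ∈ e, ∃ f ∈ M, ∃ b ∈ f, G.dist a b = 5 := by
  classical
  have hex : ∃ n, ∃ e ∈ G.edgeSet, (∀ a ∈ e, ∀ f ∈ M, ∀ b ∈ f, 5 ≤ G.dist a b) ∧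
      ∃ a ∈ e, ∃ f ∈ M, ∃ b ∈ f, G.dist a b = n := by
    obtain ⟨f, hf⟩ := hM
    exact ⟨_, e, he, hfar, e.out.1, Sym2.out_fst_mem e, f, hf, f.out.1, Sym2.out_fst_mem f, rfl⟩
  have hmin := fun m => Nat.find_min' (m := m) hex
  obtain ⟨e', he', hfar', a, ha, f, hf, b, hb, hab⟩ := Nat.find_spec hex
  set n := Nat.find hex
  have hn : 5 ≤ n := hab ▸ hfar' a ha f hf b hb
  rcases hn.eq_or_lt with h5 | h5
  · exact ⟨e', he', hfar', a, ha, f, hf, b, hb, hab.trans h5.symm⟩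
  exfalso
  obtain ⟨p, hp⟩ := hG.exists_walk_length_eq_dist a b
  cases p with
  | nil => simp at hab; omega
  | @cons _ c _ hac p =>
    rw [Walk.length_cons] at hp
    have hcb := dist_le p
    have := hmin (G.dist c b) ⟨s(a, c), hac, ?_, c, by simp, f, hf, b, hb, rfl⟩
    · omega
    intro x hx f' hf' b' hb'
    rcases Sym2.mem_iff.1 hx with rfl | rfl
    · exact hfar' _ ha f' hf' b' hb'
    · have h₁ := hmin (G.dist a b') ⟨e', he', hfar', a, ha, f', hf', b', hb', rfl⟩
      have h₂ : G.dist a b' ≤ G.dist a x + G.dist x b' := hG.dist_triangle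
      rw [dist_eq_one_iff_adj.2 hac] at h₂
      omega

theorem IsLinkedPacking.insert_edge {M : Set (Sym2 V)}
    (hM : G.IsLinkedPacking M) {e : Sym2 V} (he : e ∈ G.edgeSet) (heM : e ∉ M)
    (hfar : ∀ a ∈ e, ∀ f ∈ M, ∀ b ∈ f, 5 ≤ G.dist a b) {a : V} (ha : a ∈ e) {f : Sym2 V}
    (hf : f ∈ M) {b : V} (hb : b ∈ f) (hab : G.dist a b ≤ 5) :
    G.IsLinkedPacking (insert e M) where
  subset_edgeSet := Set.insert_subset he hM.subset_edgeSet
  five_le_dist := by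
    rintro g (rfl | hg) h (rfl | hh) hne x hx y hy
    · exact absurd rfl hne
    · exact hfar x hx h hh y hy
    · exact dist_comm (G := G) ▸ hfar y hy g hg x hx
    · exact hM.five_le_dist g hg h hh hne x hx y hy
  connected := by
    have hadj : G.closePairs.Adj e f := ⟨fun h => heM (h ▸ hf), a, ha, b, hb, hab⟩
    have heq : insert e M = {e, f} ∪ M := by
      ext g
      simp only [Set.mem_insert_iff, Set.mem_union, Set.mem_singleton_iff]
      grind
    rw [heq]
    exact induce_union_connected (induce_pair_connected_of_adj hadj).preconnected
      hM.connected.preconnected ⟨f, by simp, hf⟩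

theorem exists_isLinkedPacking_cover [Finite V] (hG : G.Connected) (hne : G.edgeSet.Nonempty) :
    ∃ M, G.IsLinkedPacking M ∧
      ∀ e ∈ G.edgeSet, ∃ a ∈ e, ∃ f ∈ M, ∃ b ∈ f, G.dist a b ≤ 4 := by
  obtain ⟨e₀, he₀⟩ := hne
  have hsingle : G.IsLinkedPacking {e₀} :=
    { subset_edgeSet := by simpa using he₀
      five_le_dist := by
        rintro e rfl f rfl h
        exact absurd rfl h
      connected := by
        rw [induce_singleton_eq_top]
        exact connected_top }
  obtain ⟨M, hM⟩ := (Set.toFinite {M | G.IsLinkedPacking M}).exists_maximal ⟨_, hsingle⟩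
  have hMp : G.IsLinkedPacking M := hM.prop
  refine ⟨M, hMp, fun e he => ?_⟩
  by_contra! hcon
  obtain ⟨e', he', hfar, a, ha, f, hf, b, hb, hab⟩ := exists_edge_at_dist_five hG
    (Set.nonempty_coe_sort.1 hMp.connected.nonempty) he hcon
  have heM : e' ∉ M := fun h => by simpa using hfar a ha e' h a ha
  exact heM (hM.le_of_ge (hMp.insert_edge he' heM hfar ha hf hb hab.le) (Set.subset_insert _ _)
    (Set.mem_insert _ _))

/-- The vertices can be distributed over the edges of the packing so that each vertex is at distance
at most five from its edge and each edge receives all its two-step neighbours. -/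
theorem IsLinkedPacking.exists_assignment (hG : G.Connected) {M : Set (Sym2 V)}
    (hM : G.IsLinkedPacking M) (hnbr : ∀ v, ∃ w, G.Adj v w)
    (hcov : ∀ e ∈ G.edgeSet, ∃ a ∈ e, ∃ f ∈ M, ∃ b ∈ f, G.dist a b ≤ 4) :
    ∃ φ : V → M, (∀ v, ∃ a ∈ (φ v).1, G.dist v a ≤ 5) ∧
      ∀ e : M, ∀ v ∈ G.twoStepNeighbors e.1, φ v = e := by
  have key : ∀ v, ∃ e : M, (∃ a ∈ e.1, G.dist v a ≤ 5) ∧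
      ∀ f : M, v ∈ G.twoStepNeighbors f.1 → e = f := by
    intro v
    by_cases hv : ∃ e : M, v ∈ G.twoStepNeighbors e.1
    · obtain ⟨e, he⟩ := hv
      obtain ⟨a, ha, hva⟩ := dist_le_two_of_mem_twoStepNeighbors he
      refine ⟨e, ⟨a, ha, by omega⟩, fun f hf => ?_⟩
      obtain ⟨b, hb, hvb⟩ := dist_le_two_of_mem_twoStepNeighbors hf
      by_contra hef
      have h₁ := hM.five_le_dist e e.2 f f.2 (fun h => hef (Subtype.ext h)) a ha b hb
      have h₂ : G.dist a b ≤ G.dist a v + G.dist v b := hG.dist_triangle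
      rw [dist_comm (u := a) (v := v)] at h₂
      omega
    · obtain ⟨w, hvw⟩ := hnbr v
      obtain ⟨a, ha, f, hf, b, hb, hab⟩ := hcov s(v, w) hvw
      have h₁ := dist_le_one_of_mem_edge (e := s(v, w)) hvw (Sym2.mem_mk_left v w) ha
      have h₂ : G.dist v b ≤ G.dist v a + G.dist a b := hG.dist_triangle
      exact ⟨⟨f, hf⟩, ⟨b, hb, by omega⟩, fun g hg => absurd ⟨g, hg⟩ hv⟩
  choose φ h₁ h₂ using key
  exact ⟨φ, h₁, fun e v hv => h₂ v e hv⟩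

end Packing

end SimpleGraph

theorem stmt_7 {V : Type*} [Fintype V] (G : SimpleGraph V) [DecidableRel G.Adj]
    (hG : G.Connected) (hg : 6 ≤ G.egirth) (n δ : ℕ)
    (hn : n = Fintype.card V) (hδ : δ = G.minDegree) (h3 : 3 ≤ δ) :
    avec G ≤ 9 / 2 * (⌈(n : ℝ) / ((2 * δ ^ 2 - 2 * δ + 2 : ℕ) : ℝ)⌉ : ℝ) + 8 := by
  classical
  subst hn hδ
  have := hG.nonempty
  have hnbr : ∀ v, ∃ w, G.Adj v w := fun v =>
    (G.degree_pos_iff_exists_adj v).1 (lt_of_lt_of_le (by omega) (G.minDegree_le_degree v))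
  have hedge : G.edgeSet.Nonempty := by
    obtain ⟨w, hw⟩ := hnbr (Classical.arbitrary V)
    exact ⟨s(_, w), hw⟩
  obtain ⟨M, hM, hcov⟩ := exists_isLinkedPacking_cover hG hedge
  obtain ⟨φ, hφ, hφ'⟩ := hM.exists_assignment hG hnbr hcov
  obtain ⟨T, hTle, hT⟩ := hM.connected.exists_isTree_le
  have := hM.connected.nonempty
  choose far hfar using fun e : M => Finite.exists_max (T.dist e)
  set d : ℝ := ((2 * G.minDegree ^ 2 - 2 * G.minDegree + 2 : ℕ) : ℝ) with hd
  have hd0 : 0 < d := by rw [hd]; exact_mod_cast Nat.succ_pos _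
  set N : ℝ := (Fintype.card V : ℝ) / d with hN
  have hecc : ∀ v, (_root_.eccent G v : ℝ) ≤ 6 * (T.dist (φ v) (far (φ v)) : ℝ) + 11 := by
    intro v
    have : _root_.eccent G v ≤ 6 * T.dist (φ v) (far (φ v)) + 11 := by
      refine csSup_le (Set.range_nonempty _) ?_
      rintro _ ⟨u, rfl⟩
      obtain ⟨a, ha, hva⟩ := hφ v
      obtain ⟨b, hb, hub⟩ := hφ u
      obtain ⟨p, hp⟩ := hT.connected.exists_walk_length_eq_dist (φ v) (φ u)
      have h₁ := hM.dist_le_of_walk hG (p.mapLe hTle) ha hb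
      rw [Walk.length_mapLe, hp] at h₁
      have h₂ := hfar (φ v) (φ u)
      have h₃ : G.dist v u ≤ G.dist v a + G.dist a u := hG.dist_triangle
      have h₄ : G.dist a u ≤ G.dist a b + G.dist b u := hG.dist_triangle
      rw [dist_comm (u := b)] at h₄
      omega
    exact_mod_cast this
  set w : M → ℝ := fun e => ((Finset.univ.filter fun v => φ v = e).card : ℝ) / d with hw
  have hw1 : ∀ e, 1 ≤ w e := by
    intro e
    rw [hw, one_le_div hd0, hd]
    norm_cast
    refine (le_ncard_twoStepNeighbors hg (by omega) (hM.subset_edgeSet e.2)).trans ?_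
    rw [← Set.ncard_coe_finset]
    exact Set.ncard_le_ncard (fun v hv => by simpa using hφ' e v hv)
  have hwsum : ∑ e, w e = N := by
    rw [hw, ← Finset.sum_div, hN, ← Nat.cast_sum,
      ← Finset.card_eq_sum_card_fiberwise (fun _ _ => Finset.mem_coe.2 (Finset.mem_univ _))]
    rfl
  have hfib : ∑ v, (T.dist (φ v) (far (φ v)) : ℝ) = d * ∑ e, w e * (T.dist e (far e) : ℝ) := by
    rw [← Finset.sum_fiberwise (s := Finset.univ) (g := φ), Finset.mul_sum]
    refine Finset.sum_congr rfl fun e _ => ?_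
    rw [Finset.sum_congr rfl (g := fun _ => (T.dist e (far e) : ℝ))
      fun v hv => by rw [(Finset.mem_filter.1 hv).2], Finset.sum_const, nsmul_eq_mul, hw]
    field_simp
  have htree := hT.sum_weight_mul_dist_le w hw1 far
  rw [hwsum] at htree
  have hcard : (0 : ℝ) < Fintype.card V := by exact_mod_cast Fintype.card_pos
  have hNd : d * N = Fintype.card V := by rw [hN]; field_simp
  have hmain : avec G ≤ 9 / 2 * N + 8 := by
    rw [avec, finsum_eq_sum_of_fintype, Nat.card_eq_fintype_card, div_le_iff₀ hcard]
    calc ∑ v, (_root_.eccent G v : ℝ)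
        ≤ ∑ v, (6 * (T.dist (φ v) (far (φ v)) : ℝ) + 11) := Finset.sum_le_sum fun v _ => hecc v
      _ = 6 * (d * ∑ e, w e * (T.dist e (far e) : ℝ)) + 11 * Fintype.card V := by
          rw [Finset.sum_add_distrib, ← Finset.mul_sum, hfib]
          simp [mul_comm]
      _ ≤ 6 * (d * (N * (3 / 4 * N - 1 / 2))) + 11 * Fintype.card V := by gcongr
      _ = (9 / 2 * N + 8) * Fintype.card V := by rw [← hNd]; ring
  linarith [Int.le_ceil N]
end
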